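/- For any (K, L, M_a, M_p, N) CW-MAP caching scheme with N ≥ K ≥ 1, L ≥ 1, file size B ≥ 1 and worst-case rate R, the following cut-set inequality holds for every s ∈ {1,...,K}: ⌊N/s⌋·R + s·M_p + min(s+L−1, K)·M_a ≥ s·⌊N/s⌋. (The proof exhibits, for each of ⌊N/s⌋ suitably chosen demand vectors, that the broadcasts together with the contents of access caches 1,...,min(s+L−1,K) and private caches 1,...,s determine s·⌊N/s⌋ distinct files, and counts bits.) -/

import Mathlib

/-- A `(K, L, M_a, M_p, N)` CW-MAP caching scheme with file size `B`.
Files are elements of `{0,1}^B`; each of the `K` access caches stores at most `Ma * B` bits,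
each of the `K` users' private caches stores at most `Mp * B` bits, the broadcast for demand
vector `d` is a bit string (of length `bLen d`), and user `u` can decode its demanded file
`W (d u)` from the broadcast, the contents of the `L` access caches `u, u+1, ..., u+L-1`
(mod `K`), and its private cache. -/
structure CWMAPScheme (K L N B : ℕ) (Ma Mp : ℝ) where
  hK : 0 < K
  aLen : Fin K → ℕ
  aLen_le : ∀ k : Fin K, (aLen k : ℝ) ≤ Ma * B
  aPlace : (k : Fin K) → (Fin N → Fin B → Bool) → (Fin (aLen k) → Bool)
  pLen : Fin K → ℕ
  pLen_le : ∀ u : Fin K, (pLen u : ℝ) ≤ Mp * B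
  pPlace : (u : Fin K) → (Fin N → Fin B → Bool) → (Fin (pLen u) → Bool)
  bLen : (Fin K → Fin N) → ℕ
  bEnc : (d : Fin K → Fin N) → (Fin N → Fin B → Bool) → (Fin (bLen d) → Bool)
  decode : (u : Fin K) → (d : Fin K → Fin N) →
    (Fin (bLen d) → Bool) →
    ((j : Fin L) → Fin (aLen ⟨((u : ℕ) + (j : ℕ)) % K, Nat.mod_lt _ hK⟩) → Bool) →
    (Fin (pLen u) → Bool) → (Fin B → Bool)
  decode_correct : ∀ (u : Fin K) (d : Fin K → Fin N) (W : Fin N → Fin B → Bool),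
    decode u d (bEnc d W)
      (fun j => aPlace ⟨((u : ℕ) + (j : ℕ)) % K, Nat.mod_lt _ hK⟩ W) (pPlace u W) = W (d u)

/-- The scheme has worst-case rate at most `R`: every broadcast has length at most `R * B`. -/
def CWMAPScheme.rateLE {K L N B : ℕ} {Ma Mp : ℝ} (C : CWMAPScheme K L N B Ma Mp) (R : ℝ) : Prop :=
  ∀ d : Fin K → Fin N, (C.bLen d : ℝ) ≤ R * B

/-- Pad a list of `m` files to a list of `N` files by zero files. -/
def padFiles {m N B : ℕ} (x : Fin m → Fin B → Bool) (f : Fin N) : Fin B → Bool :=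
  if h : (f : ℕ) < m then x ⟨f, h⟩ else fun _ => false

/-- An injective map from `m` files of `B` bits to three families of bit strings can exist
only if the total length of the bit strings is at least `m * B`. -/
lemma mul_le_sum_add_sum_add_sum_of_injective {m B n s t : ℕ} {b : Fin n → ℕ} {p : Fin s → ℕ}
    {a : Fin t → ℕ}
    (f : (Fin m → Fin B → Bool) → ((i : Fin n) → Fin (b i) → Bool) ×
      ((u : Fin s) → Fin (p u) → Bool) × ((k : Fin t) → Fin (a k) → Bool))
    (hf : Function.Injective f) :
    m * B ≤ ∑ i, b i + (∑ u, p u + ∑ k, a k) := by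
  have h := Fintype.card_le_of_injective f hf
  simp only [Fintype.card_prod, Fintype.card_pi, Fintype.card_bool, Finset.prod_const,
    Finset.card_univ, Fintype.card_fin, Finset.prod_pow_eq_pow_sum, ← pow_add, ← pow_mul] at h
  rw [mul_comm]
  exact (Nat.pow_le_pow_iff_right (by norm_num)).1 h

/-- Two file lists that agree on the broadcast for `d`, on the access caches reached by user `u`
and on the private cache of `u` agree on the file demanded by `u`. -/
lemma CWMAPScheme.file_eq_of_agree {K L N B : ℕ} {Ma Mp : ℝ} (C : CWMAPScheme K L N B Ma Mp)
    (u : Fin K) (d : Fin K → Fin N) {W W' : Fin N → Fin B → Bool}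
    (hb : C.bEnc d W = C.bEnc d W') (hp : C.pPlace u W = C.pPlace u W')
    (ha : ∀ j : Fin L, C.aPlace ⟨((u : ℕ) + (j : ℕ)) % K, Nat.mod_lt _ C.hK⟩ W =
      C.aPlace ⟨((u : ℕ) + (j : ℕ)) % K, Nat.mod_lt _ C.hK⟩ W') :
    W (d u) = W' (d u) := by
  rw [← C.decode_correct u d W, ← C.decode_correct u d W', hb, hp, funext ha]

/-- Users `u < s` reach only the first `min (s + L - 1) K` access caches. -/
lemma add_mod_lt_min {K L s u j : ℕ} (hK : 0 < K) (hu : u < s) (hj : j < L) :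
    (u + j) % K < min (s + L - 1) K := by
  have h1 := Nat.mod_le (u + j) K
  have h2 := Nat.mod_lt (u + j) hK
  omega

/-- The cut-set bound in bits: the broadcasts for `n` demand vectors, `s` private caches and
`min (s + L - 1) K` access caches determine `n * s` files. -/
lemma CWMAPScheme.exists_demands_mul_le {K L N B : ℕ} {Ma Mp : ℝ}
    (C : CWMAPScheme K L N B Ma Mp) {s n : ℕ} (hs : 0 < s) (hsK : s ≤ K) (hn : n * s ≤ N) :
    ∃ d : Fin n → Fin K → Fin N,
      n * s * B ≤ ∑ i, C.bLen (d i) + (∑ u : Fin s, C.pLen (Fin.castLE hsK u) +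
        ∑ k : Fin (min (s + L - 1) K), C.aLen (Fin.castLE (min_le_right _ _) k)) := by
  let d : Fin n → Fin K → Fin N := fun i k =>
    Fin.castLE hn (finProdFinEquiv (i, ⟨(k : ℕ) % s, Nat.mod_lt _ hs⟩))
  refine ⟨d, mul_le_sum_add_sum_add_sum_of_injective
    (fun x => (fun i => C.bEnc (d i) (padFiles x),
      fun u => C.pPlace (Fin.castLE hsK u) (padFiles x),
      fun k => C.aPlace (Fin.castLE (min_le_right _ _) k) (padFiles x))) ?_⟩
  intro x y hxy
  simp only [Prod.mk.injEq] at hxy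
  obtain ⟨hb, hp, ha⟩ := hxy
  funext f
  obtain ⟨⟨i, u⟩, rfl⟩ := finProdFinEquiv.surjective f
  have key := C.file_eq_of_agree (Fin.castLE hsK u) (d i) (congrFun hb i) (congrFun hp u)
    fun j => congrFun ha ⟨_, add_mod_lt_min C.hK u.isLt j.isLt⟩
  have hd : d i (Fin.castLE hsK u) = Fin.castLE hn (finProdFinEquiv (i, u)) := by
    simp [d, Nat.mod_eq_of_lt u.isLt]
  have hpad : ∀ z : Fin (n * s) → Fin B → Bool, ∀ g, padFiles z (Fin.castLE hn g) = z g :=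
    fun z g => by simp [padFiles]
  rwa [hd, hpad, hpad] at key

/-- **Cut-set inequality for the CW-MAP network.**
For any `(K, L, M_a, M_p, N)` CW-MAP caching scheme with `N ≥ K ≥ 1`, `L ≥ 1`, file size
`B ≥ 1` and worst-case rate `R`, for every `s ∈ {1, ..., K}` we have
`⌊N/s⌋·R + s·M_p + min(s+L−1, K)·M_a ≥ s·⌊N/s⌋`. -/
theorem cwmap_cutset_inequality
    (K L N B : ℕ) (Ma Mp R : ℝ) (hMa : 0 ≤ Ma) (hMp : 0 ≤ Mp) (hR : 0 ≤ R)
    (hK : 1 ≤ K) (hKN : K ≤ N) (hL : 1 ≤ L) (hB : 1 ≤ B)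
    (C : CWMAPScheme K L N B Ma Mp) (hrate : C.rateLE R) :
    ∀ s ∈ Finset.Icc 1 K,
      (s : ℝ) * ((N / s : ℕ) : ℝ) ≤
        ((N / s : ℕ) : ℝ) * R + (s : ℝ) * Mp + ((min (s + L - 1) K : ℕ) : ℝ) * Ma := by
  intro s hs
  obtain ⟨hs1, hsK⟩ := Finset.mem_Icc.1 hs
  obtain ⟨d, hd⟩ := C.exists_demands_mul_le hs1 hsK (Nat.div_mul_le_self N s)
  have hd' : ((N / s : ℕ) : ℝ) * s * B ≤ ∑ i, (C.bLen (d i) : ℝ) +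
      (∑ u : Fin s, (C.pLen (Fin.castLE hsK u) : ℝ) +
        ∑ k : Fin (min (s + L - 1) K), (C.aLen (Fin.castLE (min_le_right _ _) k) : ℝ)) := by
    exact_mod_cast hd
  have hb := Finset.sum_le_card_nsmul Finset.univ _ _ fun i _ => hrate (d i)
  have hp := Finset.sum_le_card_nsmul Finset.univ _ _ fun (u : Fin s) _ =>
    C.pLen_le (Fin.castLE hsK u)
  have ha := Finset.sum_le_card_nsmul Finset.univ _ _ fun (k : Fin (min (s + L - 1) K)) _ =>
    C.aLen_le (Fin.castLE (min_le_right _ _) k)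
  simp only [Finset.card_univ, Fintype.card_fin, nsmul_eq_mul] at hb hp ha
  have hB' : (0 : ℝ) < B := by exact_mod_cast hB
  refine le_of_mul_le_mul_right ?_ hB'
  linarith
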